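/- Let d, e ≥ 1 with r = de ≥ 2 and ℓ ≥ 2, and let W = G(de, e, ℓ) ≤ GL(ℓ,ℂ) with reflection arrangement A(W), order multiplicity ω(H) = e_H, and Coxeter number h = (1/ℓ)·Σ_{H∈A(W)} e_H (explicitly h = (ℓ−1)r + d when d ≥ 2, and h = (ℓ−1)r when d = 1). Then for every m ∈ ℕ the reflection multi-arrangement (A(W), mω) is free and all ℓ of its exponents equal mh; that is, D(A(W), mω) admits an S-basis of ℓ homogeneous derivations, each of polynomial degree mh. -/

import Mathlib

open MvPolynomial

noncomputable section

abbrev VecV (ℓ : ℕ) := Fin ℓ → ℂ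
abbrev PolyS (ℓ : ℕ) := MvPolynomial (Fin ℓ) ℂ
abbrev GLV (ℓ : ℕ) := (Module.End ℂ (VecV ℓ))ˣ

/-- The degree-one polynomial associated with a linear functional. -/
def formPoly {ℓ : ℕ} (φ : Module.Dual ℂ (VecV ℓ)) : PolyS ℓ :=
  ∑ i, MvPolynomial.C (φ (Pi.single i 1)) * MvPolynomial.X i

def IsReflection {ℓ : ℕ} (w : Module.End ℂ (VecV ℓ)) : Prop :=
  Module.finrank ℂ (LinearMap.ker (w - 1)) = ℓ - 1

def reflArr {ℓ : ℕ} (W : Subgroup (GLV ℓ)) : Set (Submodule ℂ (VecV ℓ)) :=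
  { H | ∃ w ∈ W, IsReflection (w : Module.End ℂ (VecV ℓ)) ∧
      H = LinearMap.ker ((w : Module.End ℂ (VecV ℓ)) - 1) }

def orderMult {ℓ : ℕ} (W : Subgroup (GLV ℓ)) (H : Submodule ℂ (VecV ℓ)) : ℕ :=
  Nat.card {w : GLV ℓ // w ∈ W ∧ ∀ v ∈ H, (w : Module.End ℂ (VecV ℓ)) v = v}

/-- Membership in the module of derivations of the multi-arrangement. -/
def InDeriv {ℓ : ℕ} (A : Set (Submodule ℂ (VecV ℓ))) (ν : Submodule ℂ (VecV ℓ) → ℕ)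
    (θ : Derivation ℂ (PolyS ℓ) (PolyS ℓ)) : Prop :=
  ∀ H ∈ A, ∀ φ : Module.Dual ℂ (VecV ℓ), φ ≠ 0 → LinearMap.ker φ = H →
    θ (formPoly φ) ∈ Ideal.span {formPoly φ ^ ν H}

def IsHomogDeriv {ℓ : ℕ} (θ : Derivation ℂ (PolyS ℓ) (PolyS ℓ)) (p : ℕ) : Prop :=
  ∀ i, (θ (MvPolynomial.X i)).IsHomogeneous p

def IsFreeWithExponents {ℓ : ℕ} (P : Derivation ℂ (PolyS ℓ) (PolyS ℓ) → Prop)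
    (e : Fin ℓ → ℕ) : Prop :=
  ∃ θ : Fin ℓ → Derivation ℂ (PolyS ℓ) (PolyS ℓ),
    (∀ i, P (θ i)) ∧
    LinearIndependent (PolyS ℓ) θ ∧
    (∀ η, P η → η ∈ Submodule.span (PolyS ℓ) (Set.range θ)) ∧
    (∀ i, IsHomogDeriv (θ i) (e i))

def WellGenerated {ℓ : ℕ} (W : Subgroup (GLV ℓ)) : Prop :=
  ∃ T : Finset (GLV ℓ), T.card = ℓ ∧
    (∀ w ∈ T, w ∈ W ∧ IsReflection (w : Module.End ℂ (VecV ℓ))) ∧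
    Subgroup.closure (T : Set (GLV ℓ)) = W

/-- If `α` divides `E` and `α ^ s` divides `D E + c E`, where `D α` is prime to `α`,
then `α ^ (s + 1)` divides `E`. -/
lemma pow_succ_dvd_of_derivation {R A : Type*} [CommRing R] [CommRing A] [IsDomain A]
    [Algebra R A] [Algebra ℂ A] (D : Derivation R A A) {α E c : A} (hα : Prime α)
    (hD : ¬ α ∣ D α) {s : ℕ} (h1 : α ∣ E) (h2 : α ^ s ∣ D E + c * E) : α ^ (s + 1) ∣ E := by
  suffices H : ∀ t ≤ s, α ^ (t + 1) ∣ E from H s le_rfl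
  intro t
  induction t with
  | zero => intro _; simpa using h1
  | succ t ih =>
    intro ht
    obtain ⟨g, rfl⟩ := ih (by omega)
    obtain ⟨u, hu⟩ := (pow_dvd_pow α ht).trans h2
    rw [D.leibniz, D.leibniz_pow] at hu
    simp only [smul_eq_mul, nsmul_eq_mul, Nat.add_sub_cancel] at hu
    have h3 : α ^ t * (α * (D g + c * g - u)) = α ^ t * (-(((t + 1 : ℕ) : A) * (D α * g))) := by
      linear_combination hu
    have h4 := mul_left_cancel₀ (pow_ne_zero t hα.ne_zero) h3
    have h5 : α ∣ ((t + 1 : ℕ) : A) * (D α * g) := by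
      rw [← dvd_neg, ← h4]; exact dvd_mul_right _ _
    have h6 : IsUnit ((t + 1 : ℕ) : A) := by
      have : IsUnit (algebraMap ℂ A ((t + 1 : ℕ) : ℂ)) :=
        (IsUnit.mk0 _ (by exact_mod_cast Nat.succ_ne_zero t)).map _
      simpa using this
    have h7 : α ∣ g := by
      rcases hα.dvd_or_dvd h5 with h | h
      · exact absurd (isUnit_of_dvd_unit h h6) hα.not_isUnit
      · exact (hα.dvd_or_dvd h).resolve_left hD
    rw [pow_succ _ (t + 1)]
    exact mul_dvd_mul_left _ h7

/-- The derivation of `A[T]` acting on coefficients by `D`. -/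
def coeffDeriv {R A : Type*} [CommRing R] [CommRing A] [Algebra R A] (D : Derivation R A A) :
    Derivation R (Polynomial A) (Polynomial A) :=
  PolynomialModule.equivPolynomialSelf.toLinearMap.compDer D.mapCoeffs

lemma coeff_coeffDeriv {R A : Type*} [CommRing R] [CommRing A] [Algebra R A]
    (D : Derivation R A A) (P : Polynomial A) (c : ℕ) :
    (coeffDeriv D P).coeff c = D (P.coeff c) := by
  rfl

lemma coeffDeriv_X {R A : Type*} [CommRing R] [CommRing A] [Algebra R A]
    (D : Derivation R A A) : coeffDeriv D Polynomial.X = 0 := by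
  ext c
  rw [coeff_coeffDeriv, Polynomial.coeff_X]
  split_ifs <;> simp

lemma coeffDeriv_C {R A : Type*} [CommRing R] [CommRing A] [Algebra R A]
    (D : Derivation R A A) (a : A) : coeffDeriv D (Polynomial.C a) = Polynomial.C (D a) := by
  ext c
  rw [coeff_coeffDeriv, Polynomial.coeff_C, Polynomial.coeff_C]
  split_ifs <;> simp

lemma derivation_eval {R A : Type*} [CommRing R] [CommRing A] [Algebra R A]
    (D : Derivation R A A) (y : A) (P : Polynomial A) :
    D (P.eval y) = (coeffDeriv D P).eval y + P.derivative.eval y * D y := by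
  induction P using Polynomial.induction_on' with
  | add p q hp hq => simp only [Polynomial.eval_add, map_add, hp, hq]; ring
  | monomial n a =>
    have : coeffDeriv D (Polynomial.monomial n a) = Polynomial.monomial n (D a) := by
      ext c
      rw [coeff_coeffDeriv, Polynomial.coeff_monomial, Polynomial.coeff_monomial]
      split_ifs <;> simp
    rw [this]
    simp only [Polynomial.eval_monomial, D.leibniz, D.leibniz_pow, Polynomial.derivative_monomial,
      smul_eq_mul, nsmul_eq_mul]
    ring

/-- The operator `P(T) ↦ Q(T)` determined by `d/dt (t ^ (1 - N) Q(t ^ r)) = t ^ (-N) P(t ^ r)`. -/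
def integ {A : Type*} [CommRing A] [Algebra ℂ A] (r N : ℕ) : Polynomial A →ₗ[A] Polynomial A :=
  Polynomial.lsum fun c => algebraMap ℂ A (((r : ℂ) * c + 1 - N)⁻¹) • Polynomial.monomial c

lemma coeff_integ {A : Type*} [CommRing A] [Algebra ℂ A] (r N : ℕ) (P : Polynomial A) (c : ℕ) :
    (integ r N P).coeff c = algebraMap ℂ A (((r : ℂ) * c + 1 - N)⁻¹) * P.coeff c := by
  simp only [integ, Polynomial.lsum_apply, Polynomial.sum_def, Polynomial.finsetSum_coeff,
    LinearMap.smul_apply, Polynomial.coeff_smul, Polynomial.coeff_monomial, smul_eq_mul]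
  rw [Finset.sum_eq_single c]
  · simp
  · intro b _ hb
    simp [hb]
  · intro hc
    simp [Polynomial.notMem_support_iff.mp hc]

lemma integ_ode {A : Type*} [CommRing A] [Algebra ℂ A] {r N : ℕ} (hr : 2 ≤ r) (hN : r ∣ N)
    (P : Polynomial A) :
    (r : Polynomial A) * (Polynomial.X * (integ r N P).derivative) + integ r N P
      - (N : Polynomial A) * integ r N P = P := by
  ext c
  have h0 : ((r : ℂ) * c + 1 - N) ≠ 0 := by
    obtain ⟨k, rfl⟩ := hN
    intro h
    have h1 : ((r * c + 1 : ℕ) : ℂ) = ((r * k : ℕ) : ℂ) := by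
      push_cast
      push_cast at h
      linear_combination h
    have h2 : r * c + 1 = r * k := by exact_mod_cast h1
    have h3 : r ∣ 1 := (Nat.dvd_add_right (dvd_mul_right r c)).mp (h2 ▸ dvd_mul_right r k)
    have := Nat.le_of_dvd one_pos h3
    omega
  have h1 : (Polynomial.X * (integ r N P).derivative).coeff c = c * (integ r N P).coeff c := by
    cases c with
    | zero => simp
    | succ c =>
      rw [Polynomial.coeff_X_mul, Polynomial.coeff_derivative]
      push_cast
      ring
  rw [Polynomial.coeff_sub, Polynomial.coeff_add, Polynomial.coeff_natCast_mul,
    Polynomial.coeff_natCast_mul, h1, coeff_integ]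
  have h2 : algebraMap ℂ A ((r : ℂ) * c + 1 - N) *
      algebraMap ℂ A (((r : ℂ) * c + 1 - N)⁻¹) = 1 := by
    rw [← map_mul, mul_inv_cancel₀ h0, map_one]
  simp only [map_sub, map_add, map_mul, map_natCast, map_one] at h2
  linear_combination P.coeff c * h2

lemma coeffDeriv_integ {A : Type*} [CommRing A] [Algebra ℂ A] (r N : ℕ) (D : Derivation ℂ A A)
    (P : Polynomial A) : coeffDeriv D (integ r N P) = integ r N (coeffDeriv D P) := by
  ext c
  simp only [coeff_coeffDeriv, coeff_integ, D.leibniz, D.map_algebraMap, smul_eq_mul, mul_zero,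
    add_zero]

/-- The linear form `x_i - ζ x_j` as a polynomial. -/
def diffForm {ℓ : ℕ} (i j : Fin ℓ) (ζ : ℂ) : PolyS ℓ := X i - C ζ * X j

/-- A polynomial multiple of `f(x_i) - ζ f(x_j)` where `f(t) = t ^ (1 - N) Q(t ^ r)`. -/
def integDiff {ℓ : ℕ} (r N : ℕ) (i j : Fin ℓ) (ζ : ℂ) (P : Polynomial (PolyS ℓ)) : PolyS ℓ :=
  X j ^ N * X i * (integ r N P).eval (X i ^ r) - C ζ * X i ^ N * X j * (integ r N P).eval (X j ^ r)

lemma integDiff_smul {ℓ : ℕ} (r N : ℕ) (i j : Fin ℓ) (ζ : ℂ) (a : PolyS ℓ)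
    (P : Polynomial (PolyS ℓ)) : integDiff r N i j ζ (a • P) = a * integDiff r N i j ζ P := by
  simp only [integDiff, map_smul, Polynomial.eval_smul, smul_eq_mul]
  ring

lemma diffForm_dvd_pow_sub {ℓ : ℕ} {r N : ℕ} (hN : r ∣ N) (i j : Fin ℓ) {ζ : ℂ} (hζ : ζ ^ r = 1) :
    diffForm i j ζ ∣ X i ^ N - X j ^ N := by
  obtain ⟨k, rfl⟩ := hN
  have h := sub_dvd_pow_sub_pow (X i : PolyS ℓ) (C ζ * X j) (r * k)
  rwa [mul_pow (C ζ), ← map_pow, pow_mul ζ, hζ, one_pow, map_one, one_mul] at h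

lemma diffForm_dvd_integDiff {ℓ : ℕ} {r N : ℕ} (hN : r ∣ N) (i j : Fin ℓ) {ζ : ℂ}
    (hζ : ζ ^ r = 1) (P : Polynomial (PolyS ℓ)) :
    diffForm i j ζ ∣ integDiff r N i j ζ P := by
  have h1 := diffForm_dvd_pow_sub hN i j hζ
  have h2 := (diffForm_dvd_pow_sub dvd_rfl i j hζ).trans
    (Polynomial.sub_dvd_eval_sub (X i ^ r) (X j ^ r) (integ r N P))
  have h : integDiff r N i j ζ P = X j ^ N * (integ r N P).eval (X i ^ r) * diffForm i j ζ
      - C ζ * X j * (integ r N P).eval (X i ^ r) * (X i ^ N - X j ^ N)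
      + C ζ * X i ^ N * X j *
        ((integ r N P).eval (X i ^ r) - (integ r N P).eval (X j ^ r)) := by
    simp only [integDiff, diffForm]
    ring
  rw [h]
  exact dvd_add (dvd_sub (dvd_mul_left _ _) (h1.mul_left _)) (h2.mul_left _)

/-- The Euler derivation `x_i ∂/∂x_i`. -/
def eulerDeriv {ℓ : ℕ} (i : Fin ℓ) : Derivation ℂ (PolyS ℓ) (PolyS ℓ) :=
  (X i : PolyS ℓ) • pderiv i

lemma eulerDeriv_X_self {ℓ : ℕ} (i : Fin ℓ) : eulerDeriv i (X i) = X i := by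
  simp [eulerDeriv]

lemma eulerDeriv_X_of_ne {ℓ : ℕ} {i j : Fin ℓ} (h : j ≠ i) : eulerDeriv i (X j) = 0 := by
  simp [eulerDeriv, pderiv_X_of_ne h]

lemma eulerDeriv_C {ℓ : ℕ} (i : Fin ℓ) (a : ℂ) : eulerDeriv i (C a) = 0 := by
  simp [eulerDeriv]

lemma eulerDeriv_integDiff {ℓ : ℕ} {r N : ℕ} (hr : 2 ≤ r) (hN : r ∣ N) {i j : Fin ℓ} (hij : i ≠ j)
    (ζ : ℂ) (P : Polynomial (PolyS ℓ)) :
    eulerDeriv i (integDiff r N i j ζ P) - (N : PolyS ℓ) * integDiff r N i j ζ P =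
      X j ^ N * X i * P.eval (X i ^ r) + integDiff r N i j ζ (coeffDeriv (eulerDeriv i) P) := by
  have ode := congrArg (Polynomial.eval (X i ^ r)) (integ_ode hr hN P)
  simp only [Polynomial.eval_add, Polynomial.eval_sub, Polynomial.eval_mul, Polynomial.eval_X,
    Polynomial.eval_natCast] at ode
  have hpow (n : ℕ) : (n : PolyS ℓ) * X i ^ (n - 1) * X i = (n : PolyS ℓ) * X i ^ n := by
    cases n with
    | zero => simp
    | succ n => rw [Nat.add_sub_cancel, pow_succ (X i : PolyS ℓ)]; ring
  simp only [integDiff, ← coeffDeriv_integ, map_sub, Derivation.leibniz, derivation_eval,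
    Derivation.leibniz_pow, eulerDeriv_X_self, eulerDeriv_X_of_ne hij.symm, eulerDeriv_C,
    smul_eq_mul, nsmul_eq_mul, mul_zero, zero_add, add_zero]
  linear_combination X j ^ N * X i * ode
    + X j ^ N * X i * (Polynomial.derivative (integ r N P)).eval (X i ^ r) * hpow r
    - C ζ * X j * (integ r N P).eval (X j ^ r) * hpow N

lemma pow_diffForm_dvd_integDiff {ℓ : ℕ} {r N : ℕ} (hr : 2 ≤ r) (hN : r ∣ N) {i j : Fin ℓ}
    (hij : i ≠ j) {ζ : ℂ} (hζ : ζ ^ r = 1) (hprime : Prime (diffForm i j ζ))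
    (hX : ¬ diffForm i j ζ ∣ X i)
    {R : Polynomial (PolyS ℓ)} (hR : coeffDeriv (eulerDeriv i) R = 0) {q : ℕ}
    (hj : (Polynomial.X - Polynomial.C (X j ^ r)) ^ q ∣ R) (p : ℕ) :
    diffForm i j ζ ^ (p + q + 1) ∣
      integDiff r N i j ζ ((Polynomial.X - Polynomial.C (X i ^ r)) ^ p * R) := by
  have hD : ¬ diffForm i j ζ ∣ eulerDeriv i (diffForm i j ζ) := by
    simpa [diffForm, eulerDeriv_X_self, eulerDeriv_X_of_ne hij.symm, Derivation.leibniz] using hX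
  induction p with
  | zero =>
    refine pow_succ_dvd_of_derivation (eulerDeriv i) (c := -N) hprime hD
      (diffForm_dvd_integDiff hN i j hζ _) ?_
    rw [neg_mul, ← sub_eq_add_neg, eulerDeriv_integDiff hr hN hij, pow_zero, one_mul, hR]
    have h0 : integDiff r N i j ζ 0 = 0 := by simp [integDiff]
    rw [h0, add_zero, zero_add]
    refine Dvd.dvd.mul_left ?_ _
    have h1 := map_dvd (Polynomial.evalRingHom (X i ^ r)) hj
    simp only [map_pow, map_sub, Polynomial.coe_evalRingHom, Polynomial.eval_X,
      Polynomial.eval_C] at h1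
    exact (pow_dvd_pow_of_dvd (diffForm_dvd_pow_sub dvd_rfl i j hζ) q).trans h1
  | succ p ih =>
    have e : p + 1 + q + 1 = (p + q + 1) + 1 := by ring
    rw [e]
    refine pow_succ_dvd_of_derivation (eulerDeriv i) (c := -N) hprime hD
      (diffForm_dvd_integDiff hN i j hζ _) ?_
    rw [neg_mul, ← sub_eq_add_neg, eulerDeriv_integDiff hr hN hij]
    have h1 : coeffDeriv (eulerDeriv i) ((Polynomial.X - Polynomial.C (X i ^ r)) ^ (p + 1) * R) =
        (-((p + 1 : ℕ) * (eulerDeriv i (X i ^ r))) : PolyS ℓ) •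
          ((Polynomial.X - Polynomial.C (X i ^ r)) ^ p * R) := by
      rw [Derivation.leibniz, hR, Derivation.leibniz_pow, map_sub, coeffDeriv_X, coeffDeriv_C,
        Polynomial.smul_eq_C_mul]
      simp only [smul_eq_mul, nsmul_eq_mul, map_neg, map_mul, Nat.add_sub_cancel, map_natCast]
      ring
    rw [h1, integDiff_smul]
    refine dvd_add ?_ (ih.mul_left _)
    simp

/-- The linear factor `T - x_j ^ r`. -/
def rootFactor {ℓ : ℕ} (r : ℕ) (j : Fin ℓ) : Polynomial (PolyS ℓ) :=
  Polynomial.X - Polynomial.C (X j ^ r)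

/-- The polynomial `(∏_j (T - x_j ^ r)) ^ μ * ∏_{j ≠ k} (T - x_j ^ r)`. -/
def integrand {ℓ : ℕ} (r μ : ℕ) (k : Fin ℓ) : Polynomial (PolyS ℓ) :=
  (∏ j, rootFactor r j) ^ μ * ∏ j ∈ Finset.univ.erase k, rootFactor r j

lemma coeffDeriv_prod_rootFactor {ℓ : ℕ} (r : ℕ) (i : Fin ℓ) (s : Finset (Fin ℓ)) (hs : i ∉ s) :
    coeffDeriv (eulerDeriv i) (∏ j ∈ s, rootFactor r j) = 0 := by
  refine Finset.prod_induction _ (fun P => coeffDeriv (eulerDeriv i) P = 0) ?_ ?_ ?_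
  · intro P Q hP hQ
    rw [Derivation.leibniz, hP, hQ, smul_zero, smul_zero, add_zero]
  · simp
  · intro j hj
    have hji : j ≠ i := fun h => hs (h ▸ hj)
    rw [rootFactor, map_sub, coeffDeriv_X, coeffDeriv_C, Derivation.leibniz_pow,
      eulerDeriv_X_of_ne hji]
    simp

lemma integrand_eq {ℓ : ℕ} (r μ : ℕ) {i j : Fin ℓ} (hij : i ≠ j) (k : Fin ℓ) :
    ∃ p q R, integrand r μ k = rootFactor r i ^ p * R ∧ coeffDeriv (eulerDeriv i) R = 0 ∧
      rootFactor r j ^ q ∣ R ∧ 2 * (μ + 1) ≤ p + q + 1 := by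
  set R₀ := ∏ j ∈ Finset.univ.erase i, rootFactor r j with hR₀
  have h0 : coeffDeriv (eulerDeriv i) R₀ = 0 :=
    coeffDeriv_prod_rootFactor r i _ (Finset.notMem_erase i _)
  have hfull : ∏ j, rootFactor r j = rootFactor r i * R₀ :=
    (Finset.mul_prod_erase _ _ (Finset.mem_univ i)).symm
  have hj : rootFactor r j ∣ R₀ := Finset.dvd_prod_of_mem _ (by simp [hij.symm])
  by_cases hik : i = k
  · subst hik
    refine ⟨μ, μ + 1, R₀ ^ (μ + 1), ?_, ?_, pow_dvd_pow_of_dvd hj _, by omega⟩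
    · rw [integrand, hfull, ← hR₀]; ring
    · rw [Derivation.leibniz_pow, h0]; simp
  · set R₁ := ∏ j ∈ (Finset.univ.erase k).erase i, rootFactor r j with hR₁
    have h1 : coeffDeriv (eulerDeriv i) R₁ = 0 :=
      coeffDeriv_prod_rootFactor r i _ (Finset.notMem_erase i _)
    have hk : ∏ j ∈ Finset.univ.erase k, rootFactor r j = rootFactor r i * R₁ :=
      (Finset.mul_prod_erase _ _ (by simp [hik])).symm
    have hD : coeffDeriv (eulerDeriv i) (R₀ ^ μ * R₁) = 0 := by
      rw [Derivation.leibniz, Derivation.leibniz_pow, h0, h1]; simp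
    have heq : integrand r μ k = rootFactor r i ^ (μ + 1) * (R₀ ^ μ * R₁) := by
      rw [integrand, hfull, hk]; ring
    exact ⟨μ + 1, μ, R₀ ^ μ * R₁, heq, hD, (pow_dvd_pow_of_dvd hj μ).mul_right _, by omega⟩

/-- The order of vanishing of `P(y)` is at least `s`, because of its Newton polygon. -/
def VanishOrder {A : Type*} [CommRing A] (y : A) (s : ℕ) (P : Polynomial A) : Prop :=
  ∀ c, y ^ (s - c) ∣ P.coeff c

lemma VanishOrder.mul {A : Type*} [CommRing A] {y : A} {s t : ℕ} {P Q : Polynomial A}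
    (hP : VanishOrder y s P) (hQ : VanishOrder y t Q) : VanishOrder y (s + t) (P * Q) := by
  intro c
  rw [Polynomial.coeff_mul]
  refine Finset.dvd_sum fun x hx => ?_
  rw [Finset.HasAntidiagonal.mem_antidiagonal] at hx
  refine (pow_dvd_pow y (by omega : s + t - c ≤ (s - x.1) + (t - x.2))).trans ?_
  rw [pow_add]
  exact mul_dvd_mul (hP _) (hQ _)

lemma vanishOrder_zero {A : Type*} [CommRing A] (y : A) (P : Polynomial A) :
    VanishOrder y 0 P := by
  intro c; simp

lemma vanishOrder_rootFactor {ℓ : ℕ} (r : ℕ) (i : Fin ℓ) :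
    VanishOrder (X i ^ r) 1 (rootFactor r i) := by
  intro c
  cases c with
  | zero => simp [rootFactor, -map_pow]
  | succ c => simp

lemma vanishOrder_rootFactor_pow {ℓ : ℕ} (r : ℕ) (i : Fin ℓ) (s : ℕ) :
    VanishOrder (X i ^ r) s (rootFactor r i ^ s) := by
  induction s with
  | zero => exact vanishOrder_zero _ _
  | succ s ih => rw [pow_succ]; exact ih.mul (vanishOrder_rootFactor r i)

lemma VanishOrder.pow_dvd_eval_integ {A : Type*} [CommRing A] [Algebra ℂ A] {y : A} {s : ℕ}
    {P : Polynomial A} (hP : VanishOrder y s P) (r N : ℕ) : y ^ s ∣ (integ r N P).eval y := by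
  rw [Polynomial.eval_eq_sum_range]
  refine Finset.dvd_sum fun c _ => ?_
  refine (pow_dvd_pow y (by omega : s ≤ (s - c) + c)).trans ?_
  rw [pow_add, coeff_integ]
  exact mul_dvd_mul ((hP c).mul_left _) dvd_rfl

lemma pow_dvd_eval_integrand {ℓ : ℕ} (r μ N : ℕ) (i k : Fin ℓ) :
    X i ^ (r * (if i = k then μ else μ + 1)) ∣ (integ r N (integrand r μ k)).eval (X i ^ r) := by
  rw [pow_mul]
  refine VanishOrder.pow_dvd_eval_integ ?_ r N
  have hfull : ∏ j, rootFactor r j = rootFactor r i * ∏ j ∈ Finset.univ.erase i, rootFactor r j :=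
    (Finset.mul_prod_erase _ _ (Finset.mem_univ i)).symm
  rw [integrand, hfull, mul_pow]
  have h1 := (vanishOrder_rootFactor_pow r i μ).mul
    (vanishOrder_zero (X i ^ r) ((∏ j ∈ Finset.univ.erase i, rootFactor r j) ^ μ))
  split_ifs with hik
  · have h2 := h1.mul (vanishOrder_zero (X i ^ r) (∏ j ∈ Finset.univ.erase k, rootFactor r j))
    rwa [add_zero, add_zero] at h2
  · rw [← Finset.mul_prod_erase _ _ (by simp [hik] : i ∈ Finset.univ.erase k)]
    have h2 := h1.mul ((vanishOrder_rootFactor r i).mul (vanishOrder_zero (X i ^ r)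
      (∏ j ∈ (Finset.univ.erase k).erase i, rootFactor r j)))
    rwa [add_zero, add_zero] at h2

/-- `P(T)` is homogeneous of degree `r D` when `T` has degree `r`. -/
def WeightedHom {ℓ : ℕ} (r D : ℕ) (P : Polynomial (PolyS ℓ)) : Prop :=
  P.natDegree ≤ D ∧ ∀ c b, c + b = D → (P.coeff c).IsHomogeneous (r * b)

lemma WeightedHom.mul {ℓ r D E : ℕ} {P Q : Polynomial (PolyS ℓ)}
    (hP : WeightedHom r D P) (hQ : WeightedHom r E Q) : WeightedHom r (D + E) (P * Q) := by
  refine ⟨Polynomial.natDegree_mul_le.trans (add_le_add hP.1 hQ.1), fun c b hcb => ?_⟩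
  rw [Polynomial.coeff_mul]
  refine IsHomogeneous.sum _ _ _ fun x hx => ?_
  rw [Finset.HasAntidiagonal.mem_antidiagonal] at hx
  by_cases h1 : D < x.1
  · rw [Polynomial.coeff_eq_zero_of_natDegree_lt (hP.1.trans_lt h1), zero_mul]
    exact isHomogeneous_zero _ _ _
  by_cases h2 : E < x.2
  · rw [Polynomial.coeff_eq_zero_of_natDegree_lt (hQ.1.trans_lt h2), mul_zero]
    exact isHomogeneous_zero _ _ _
  have hb : r * b = r * (D - x.1) + r * (E - x.2) := by rw [← mul_add]; congr 1; omega
  rw [hb]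
  exact (hP.2 _ _ (by omega)).mul (hQ.2 _ _ (by omega))

lemma weightedHom_one {ℓ : ℕ} (r : ℕ) : WeightedHom r 0 (1 : Polynomial (PolyS ℓ)) := by
  refine ⟨by simp, fun c b h => ?_⟩
  obtain ⟨rfl, rfl⟩ : c = 0 ∧ b = 0 := by omega
  simpa using isHomogeneous_one _ _

lemma WeightedHom.pow {ℓ r D : ℕ} {P : Polynomial (PolyS ℓ)} (hP : WeightedHom r D P) (n : ℕ) :
    WeightedHom r (n * D) (P ^ n) := by
  induction n with
  | zero => simpa using weightedHom_one r
  | succ n ih => rw [pow_succ, Nat.succ_mul]; exact ih.mul hP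

lemma weightedHom_rootFactor {ℓ : ℕ} (r : ℕ) (j : Fin ℓ) : WeightedHom r 1 (rootFactor r j) := by
  refine ⟨(Polynomial.natDegree_X_sub_C _).le, fun c b h => ?_⟩
  obtain ⟨rfl, rfl⟩ | ⟨rfl, rfl⟩ : (c = 0 ∧ b = 1) ∨ (c = 1 ∧ b = 0) := by omega
  · simpa [rootFactor, -map_pow] using (isHomogeneous_X_pow (R := ℂ) j r).neg
  · simpa [rootFactor, -map_pow, Polynomial.coeff_C] using isHomogeneous_one (Fin ℓ) ℂ

lemma weightedHom_prod_rootFactor {ℓ : ℕ} (r : ℕ) (s : Finset (Fin ℓ)) :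
    WeightedHom r s.card (∏ j ∈ s, rootFactor r j) := by
  classical
  induction s using Finset.induction_on with
  | empty => simpa using weightedHom_one r
  | insert a s ha ih =>
    rw [Finset.prod_insert ha, Finset.card_insert_of_notMem ha, add_comm]
    exact (weightedHom_rootFactor r a).mul ih

lemma weightedHom_integrand {ℓ : ℕ} (r μ : ℕ) (k : Fin ℓ) :
    WeightedHom r (μ * ℓ + (ℓ - 1)) (integrand r μ k) := by
  have h1 := (weightedHom_prod_rootFactor r (Finset.univ : Finset (Fin ℓ))).pow μ
  have h2 := weightedHom_prod_rootFactor r (Finset.univ.erase k)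
  rw [Finset.card_univ, Fintype.card_fin] at h1
  rw [Finset.card_erase_of_mem (Finset.mem_univ k), Finset.card_univ, Fintype.card_fin] at h2
  exact h1.mul h2

lemma natDegree_integ_le {A : Type*} [CommRing A] [Algebra ℂ A] (r N : ℕ) (P : Polynomial A) :
    (integ r N P).natDegree ≤ P.natDegree := by
  rw [Polynomial.natDegree_le_iff_coeff_eq_zero]
  intro c hc
  rw [coeff_integ, Polynomial.coeff_eq_zero_of_natDegree_lt hc, mul_zero]

lemma WeightedHom.isHomogeneous_eval_integ {ℓ r D : ℕ} {P : Polynomial (PolyS ℓ)}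
    (hP : WeightedHom r D P) (N : ℕ) (i : Fin ℓ) :
    ((integ r N P).eval (X i ^ r)).IsHomogeneous (r * D) := by
  rw [Polynomial.eval_eq_sum_range]
  refine IsHomogeneous.sum _ _ _ fun c hc => ?_
  have hc' : c ≤ D := by
    have := (natDegree_integ_le r N P).trans hP.1
    rw [Finset.mem_range] at hc
    omega
  have e : r * D = 0 + r * (D - c) + r * c := by rw [zero_add, ← mul_add]; congr 1; omega
  rw [e, coeff_integ, ← pow_mul]
  exact ((isHomogeneous_C _ _).mul (hP.2 _ _ (by omega))).mul (isHomogeneous_X_pow _ _)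

lemma X_pow_injective {ℓ r : ℕ} (hr : r ≠ 0) {i j : Fin ℓ}
    (h : (X i ^ r : PolyS ℓ) = X j ^ r) : i = j := by
  by_contra hij
  have := congrArg (MvPolynomial.eval (Pi.single i (1 : ℂ))) h
  simp [Ne.symm hij, hr] at this

lemma pow_rootFactor_dvd_integ {ℓ r N μ : ℕ} (hr : 2 ≤ r) (hN : r ∣ N) {i : Fin ℓ}
    {P : Polynomial (PolyS ℓ)} (hP : rootFactor r i ^ μ ∣ P)
    (h0 : (integ r N P).eval (X i ^ r) = 0) : rootFactor r i ^ (μ + 1) ∣ integ r N P := by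
  have hder : (((r : Polynomial (PolyS ℓ)) * Polynomial.X) •
      (Polynomial.derivative' : Derivation (PolyS ℓ) _ _)) (rootFactor r i) =
      (r : Polynomial (PolyS ℓ)) * Polynomial.X := by
    simp [Polynomial.derivative', rootFactor, -map_pow]
  refine pow_succ_dvd_of_derivation
    (((r : Polynomial (PolyS ℓ)) * Polynomial.X) • Polynomial.derivative')
    (c := 1 - (N : Polynomial (PolyS ℓ)))
    (Polynomial.prime_X_sub_C _) ?_ (Polynomial.dvd_iff_isRoot.mpr h0) ?_
  · rw [rootFactor] at hder
    rw [hder, Polynomial.dvd_iff_isRoot]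
    simp [show r ≠ 0 by omega]
  · have hode := integ_ode hr hN P
    have e : (((r : Polynomial (PolyS ℓ)) * Polynomial.X) •
        (Polynomial.derivative' : Derivation (PolyS ℓ) _ _)) (integ r N P) +
          (1 - (N : Polynomial (PolyS ℓ))) * integ r N P = P := by
      rw [Derivation.smul_apply, smul_eq_mul]
      change _ * Polynomial.derivative (integ r N P) + _ = _
      linear_combination hode
    rw [e]
    exact hP

lemma natDegree_prod_rootFactor {ℓ : ℕ} (r : ℕ) (s : Finset (Fin ℓ)) (n : ℕ) :
    (∏ j ∈ s, rootFactor r j ^ n).natDegree = s.card * n := by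
  rw [Polynomial.natDegree_prod_of_monic _ _ fun j _ => (Polynomial.monic_X_sub_C _).pow n]
  simp [rootFactor, -map_pow, Polynomial.natDegree_pow]

lemma integrand_independent {ℓ r N μ : ℕ} (hr : 2 ≤ r) (hN : r ∣ N) (hℓ : 1 ≤ ℓ)
    (a : Fin ℓ → PolyS ℓ)
    (h : ∀ i, ∑ k, a k * (integ r N (integrand r μ k)).eval (X i ^ r) = 0) : a = 0 := by
  have hroots {i j : Fin ℓ} (hij : i ≠ j) : (X i ^ r - X j ^ r : PolyS ℓ) ≠ 0 :=
    fun h => hij (X_pow_injective (by omega) (sub_eq_zero.mp h))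
  set P := ∑ k, a k • integrand r μ k with hPdef
  have hroot (i : Fin ℓ) : (integ r N P).eval (X i ^ r) = 0 := by
    rw [hPdef, map_sum, Polynomial.eval_finsetSum, ← h i]
    simp
  have hPmul : P = (∏ j, rootFactor r j) ^ μ *
      ∑ k, a k • ∏ j ∈ Finset.univ.erase k, rootFactor r j := by
    simp only [hPdef, integrand, Finset.mul_sum, mul_smul_comm]
  have hprod : ∏ j : Fin ℓ, rootFactor r j ^ (μ + 1) ∣ integ r N P := by
    refine Fintype.prod_dvd_of_isRelPrime ?_ fun i => pow_rootFactor_dvd_integ hr hN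
      ((pow_dvd_pow_of_dvd (Finset.dvd_prod_of_mem _ (Finset.mem_univ i)) μ).trans
        (hPmul ▸ dvd_mul_right _ _)) (hroot i)
    intro i j hij
    refine IsRelPrime.pow ?_
    have hi : Irreducible (rootFactor r i) := (Polynomial.prime_X_sub_C _).irreducible
    rw [hi.isRelPrime_iff_not_dvd, rootFactor, Polynomial.dvd_iff_isRoot]
    simpa [rootFactor, -map_pow] using hroots hij
  have hQ : integ r N P = 0 := by
    refine Polynomial.eq_zero_of_dvd_of_natDegree_lt hprod ?_
    rw [natDegree_prod_rootFactor, Finset.card_univ, Fintype.card_fin]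
    have hdeg : P.natDegree ≤ μ * ℓ + (ℓ - 1) :=
      Polynomial.natDegree_sum_le_of_forall_le _ _ fun k _ =>
        (Polynomial.natDegree_smul_le _ _).trans (weightedHom_integrand r μ k).1
    have hlt : μ * ℓ + (ℓ - 1) < ℓ * (μ + 1) := by
      rw [mul_comm ℓ, add_mul, one_mul]
      omega
    exact ((natDegree_integ_le r N P).trans hdeg).trans_lt hlt
  have hP0 : P = 0 := by
    rw [← integ_ode hr hN P, hQ]; simp
  have hcancel : ∑ k, a k • ∏ j ∈ Finset.univ.erase k, rootFactor r j = 0 := by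
    refine (mul_eq_zero.mp (hPmul.symm.trans hP0)).resolve_left (pow_ne_zero _ ?_)
    exact Finset.prod_ne_zero_iff.mpr fun j _ => Polynomial.X_sub_C_ne_zero _
  funext k
  have hk := congrArg (Polynomial.eval (X k ^ r)) hcancel
  rw [Polynomial.eval_finsetSum, Finset.sum_eq_single k] at hk
  · rw [Polynomial.eval_smul, Polynomial.eval_zero, smul_eq_mul, Polynomial.eval_prod] at hk
    refine (mul_eq_zero.mp hk).resolve_right (Finset.prod_ne_zero_iff.mpr fun j hj => ?_)
    simpa [rootFactor, -map_pow] using hroots (Finset.ne_of_mem_erase hj).symm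
  · intro i _ hik
    rw [Polynomial.eval_smul, Polynomial.eval_prod,
      Finset.prod_eq_zero (i := k) (by simp [hik.symm]) (by simp [rootFactor, -map_pow]), smul_zero]
  · simp

lemma eval_formPoly {ℓ : ℕ} (φ : Module.Dual ℂ (VecV ℓ)) (v : VecV ℓ) :
    MvPolynomial.eval v (formPoly φ) = φ v := by
  conv_rhs => rw [← Finset.univ_sum_single v]
  simp only [formPoly, map_sum, map_mul, eval_C, eval_X]
  refine Finset.sum_congr rfl fun i _ => ?_
  rw [← mul_one (v i), ← smul_eq_mul (v i) 1, Pi.single_smul, map_smul]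
  simp [mul_comm]

lemma formPoly_smul {ℓ : ℕ} (c : ℂ) (φ : Module.Dual ℂ (VecV ℓ)) :
    formPoly (c • φ) = C c * formPoly φ := by
  simp [formPoly, Finset.mul_sum, mul_assoc]

lemma formPoly_isHomogeneous {ℓ : ℕ} (φ : Module.Dual ℂ (VecV ℓ)) :
    (formPoly φ).IsHomogeneous 1 :=
  IsHomogeneous.sum _ _ _ fun i _ => isHomogeneous_C_mul_X _ i

lemma derivation_C_mul_eq {ℓ : ℕ} (θ : Derivation ℂ (PolyS ℓ) (PolyS ℓ)) (c : ℂ) (f : PolyS ℓ) :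
    θ (C c * f) = C c * θ f := by
  rw [C_mul', Derivation.map_smul, smul_eq_C_mul]

lemma derivation_formPoly {ℓ : ℕ} (θ : Derivation ℂ (PolyS ℓ) (PolyS ℓ))
    (φ : Module.Dual ℂ (VecV ℓ)) :
    θ (formPoly φ) = ∑ i, C (φ (Pi.single i 1)) * θ (X i) := by
  rw [formPoly, map_sum]
  exact Finset.sum_congr rfl fun i _ => derivation_C_mul_eq ..

lemma ker_le_of_formPoly_dvd {ℓ : ℕ} {φ ψ : Module.Dual ℂ (VecV ℓ)}
    (h : formPoly φ ∣ formPoly ψ) : LinearMap.ker φ ≤ LinearMap.ker ψ := by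
  intro v hv
  have := map_dvd (MvPolynomial.eval v) h
  rw [eval_formPoly, eval_formPoly, LinearMap.mem_ker.mp hv, zero_dvd_iff] at this
  exact this

lemma formPoly_ne_zero {ℓ : ℕ} {φ : Module.Dual ℂ (VecV ℓ)} (h : φ ≠ 0) : formPoly φ ≠ 0 := by
  intro h0
  apply h
  refine LinearMap.ext fun v => ?_
  simpa [h0] using (eval_formPoly φ v).symm

lemma prime_formPoly {ℓ : ℕ} {φ : Module.Dual ℂ (VecV ℓ)} (h : φ ≠ 0) : Prime (formPoly φ) := by
  refine (irreducible_of_totalDegree_eq_one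
    ((formPoly_isHomogeneous φ).totalDegree (formPoly_ne_zero h)) fun x hx => ?_).prime
  obtain ⟨d, hd⟩ := ne_zero_iff.mp (formPoly_ne_zero h)
  exact isUnit_iff_ne_zero.mpr fun h0 => hd (zero_dvd_iff.mp (h0 ▸ hx d))

lemma ker_eq_of_le {ℓ : ℕ} {φ ψ : Module.Dual ℂ (VecV ℓ)} (hφ : φ ≠ 0) (hψ : ψ ≠ 0)
    (h : LinearMap.ker φ ≤ LinearMap.ker ψ) : LinearMap.ker φ = LinearMap.ker ψ := by
  refine Submodule.eq_of_le_of_finrank_eq h ?_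
  have h1 := Module.Dual.finrank_ker_add_one_of_ne_zero hφ
  have h2 := Module.Dual.finrank_ker_add_one_of_ne_zero hψ
  omega

lemma isRelPrime_formPoly {ℓ : ℕ} {φ ψ : Module.Dual ℂ (VecV ℓ)} (hφ : φ ≠ 0) (hψ : ψ ≠ 0)
    (h : LinearMap.ker φ ≠ LinearMap.ker ψ) : IsRelPrime (formPoly φ) (formPoly ψ) := by
  rw [(prime_formPoly hφ).irreducible.isRelPrime_iff_not_dvd]
  exact fun hd => h (ker_eq_of_le hφ hψ (ker_le_of_formPoly_dvd hd))

lemma exists_smul_of_ker_eq {ℓ : ℕ} {φ ψ : Module.Dual ℂ (VecV ℓ)}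
    (h : LinearMap.ker φ = LinearMap.ker ψ) : ∃ c : ℂ, ψ = c • φ := by
  have := mem_span_of_iInf_ker_le_ker (L := fun _ : Unit => φ) (K := ψ) (by simp [h])
  rw [Set.range_const, Submodule.mem_span_singleton] at this
  exact this.imp fun c hc => hc.symm

lemma derivation_sum_apply {ℓ : ℕ} {I : Type*} (s : Finset I)
    (θ : I → Derivation ℂ (PolyS ℓ) (PolyS ℓ)) (f : PolyS ℓ) :
    (∑ k ∈ s, θ k) f = ∑ k ∈ s, θ k f := by
  rw [← Derivation.coeFnAddMonoidHom_apply, map_sum, Finset.sum_apply]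
  rfl

/-- If every row of `M` lies in the module of derivations attached to `α ^ n`, so does `det M`. -/
lemma pow_dvd_det {ℓ : ℕ} {φ : Module.Dual ℂ (VecV ℓ)} (hφ : φ ≠ 0) {n : ℕ}
    (M : Matrix (Fin ℓ) (Fin ℓ) (PolyS ℓ))
    (h : ∀ k, formPoly φ ^ n ∣ ∑ i, C (φ (Pi.single i 1)) * M k i) : formPoly φ ^ n ∣ M.det := by
  obtain ⟨i, hi⟩ : ∃ i, φ (Pi.single i 1) ≠ 0 := by
    by_contra! hall
    exact formPoly_ne_zero hφ (by simp [formPoly, hall])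
  set c : Fin ℓ → PolyS ℓ := fun i => C (φ (Pi.single i 1)) with hc
  have h1 : M.det * c i = ∑ k, M.adjugate i k * (M.mulVec c) k := by
    have : M.adjugate.mulVec (M.mulVec c) = M.det • c := by
      rw [Matrix.mulVec_mulVec, Matrix.adjugate_mul, Matrix.smul_mulVec, Matrix.one_mulVec]
    rw [← smul_eq_mul, ← Pi.smul_apply, ← this]
    rfl
  have hu : IsUnit (c i) := (isUnit_iff_ne_zero.mpr hi).map C
  rw [← hu.dvd_mul_right, h1]
  refine Finset.dvd_sum fun k _ => Dvd.dvd.mul_left ?_ _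
  have h2 : M.mulVec c k = ∑ i, C (φ (Pi.single i 1)) * M k i := by
    rw [Matrix.mulVec, dotProduct]
    exact Finset.sum_congr rfl fun i _ => mul_comm (M k i) (c i)
  exact h2 ▸ h k

/-- Saito's criterion. -/
lemma isFreeWithExponents_of_matrix {ℓ : ℕ} {I : Type*} [Fintype I]
    {A : Set (Submodule ℂ (VecV ℓ))} {ν : Submodule ℂ (VecV ℓ) → ℕ}
    (φ : I → Module.Dual ℂ (VecV ℓ)) (hA : A = Set.range fun a => LinearMap.ker (φ a))
    (hinj : Function.Injective fun a => LinearMap.ker (φ a)) (hφ : ∀ a, φ a ≠ 0)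
    {p : ℕ} (hp : ℓ * p = ∑ a, ν (LinearMap.ker (φ a)))
    (M : Matrix (Fin ℓ) (Fin ℓ) (PolyS ℓ))
    (hM : ∀ a k, formPoly (φ a) ^ ν (LinearMap.ker (φ a)) ∣
      ∑ i, C (φ a (Pi.single i 1)) * M k i)
    (hhom : ∀ k i, (M k i).IsHomogeneous p) (hdet : M.det ≠ 0) :
    IsFreeWithExponents (InDeriv A ν) (fun _ => p) := by
  set Q : PolyS ℓ := ∏ a, formPoly (φ a) ^ ν (LinearMap.ker (φ a)) with hQdef
  have hQdvd (N : Matrix (Fin ℓ) (Fin ℓ) (PolyS ℓ))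
      (hN : ∀ a k, formPoly (φ a) ^ ν (LinearMap.ker (φ a)) ∣
        ∑ i, C (φ a (Pi.single i 1)) * N k i) : Q ∣ N.det := by
    refine Fintype.prod_dvd_of_isRelPrime ?_ fun a => pow_dvd_det (hφ a) N (hN a)
    exact fun a b hab => (isRelPrime_formPoly (hφ a) (hφ b) (hinj.ne hab)).pow
  have hQ0 : Q ≠ 0 := Finset.prod_ne_zero_iff.mpr fun a _ => pow_ne_zero _ (formPoly_ne_zero (hφ a))
  have hQhom : Q.IsHomogeneous (ℓ * p) := by
    rw [hp]
    refine IsHomogeneous.prod _ _ _ fun a _ => ?_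
    simpa using (formPoly_isHomogeneous (φ a)).pow (ν (LinearMap.ker (φ a)))
  have hdethom : M.det.IsHomogeneous (ℓ * p) := by
    rw [Matrix.det_apply]
    refine IsHomogeneous.sum _ _ _ fun σ _ => ?_
    have h1 : (∏ i, M (σ i) i).IsHomogeneous (ℓ * p) := by
      have := IsHomogeneous.prod Finset.univ (fun i => M (σ i) i) (fun _ => p)
        fun i _ => hhom (σ i) i
      simpa using this
    rcases Int.units_eq_one_or (Equiv.Perm.sign σ) with h | h
    · simpa [h] using h1
    · simpa [h] using h1.neg
  obtain ⟨u, hu⟩ := hQdvd M hM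
  have hu0 : u ≠ 0 := fun h => hdet (by rw [hu, h, mul_zero])
  obtain ⟨c, rfl⟩ : ∃ c, u = C c := by
    refine ⟨_, totalDegree_eq_zero_iff_eq_C.mp ?_⟩
    have := totalDegree_mul_of_isDomain hQ0 hu0
    rw [← hu, hdethom.totalDegree hdet, hQhom.totalDegree hQ0] at this
    omega
  have hc : c ≠ 0 := fun h => hu0 (by rw [h, map_zero])
  refine ⟨fun k => mkDerivation ℂ (M k), fun k => ?_, ?_, fun η hη => ?_, fun k i => ?_⟩
  · intro H hH ψ hψ hker
    rw [hA] at hH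
    obtain ⟨a, rfl⟩ := hH
    obtain ⟨b, rfl⟩ := exists_smul_of_ker_eq hker.symm
    have hb : IsUnit (C b : PolyS ℓ) :=
      (isUnit_iff_ne_zero.mpr fun h => hψ (by rw [h, zero_smul])).map C
    change mkDerivation ℂ (M k) (formPoly (b • φ a)) ∈
      Ideal.span {formPoly (b • φ a) ^ ν (LinearMap.ker (φ a))}
    rw [Ideal.mem_span_singleton, formPoly_smul, mul_pow, (hb.pow _).mul_left_dvd,
      derivation_C_mul_eq, derivation_formPoly]
    refine Dvd.dvd.mul_left ?_ _
    simpa [mkDerivation_X] using hM a k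
  · rw [Fintype.linearIndependent_iff]
    intro g hg
    by_contra! hne
    refine hdet (Matrix.exists_vecMul_eq_zero_iff.mp ⟨g, fun h => ?_, ?_⟩)
    · obtain ⟨i, hi⟩ := hne
      exact hi (congrFun h i)
    · funext i
      have := congrArg (fun θ : Derivation ℂ (PolyS ℓ) (PolyS ℓ) => θ (X i)) hg
      simpa [derivation_sum_apply, mkDerivation_X, Matrix.vecMul, dotProduct] using this
  · set y : Fin ℓ → PolyS ℓ := fun i => η (X i) with hy
    have hcr (k : Fin ℓ) : Q ∣ Matrix.cramer M.transpose y k := by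
      rw [Matrix.cramer_transpose_apply]
      refine hQdvd _ fun a j => ?_
      by_cases hj : j = k
      · subst hj
        have := hη _ (hA ▸ Set.mem_range_self a) (φ a) (hφ a) rfl
        rw [Ideal.mem_span_singleton, derivation_formPoly] at this
        simpa [hy] using this
      · simpa [Matrix.updateRow_ne hj] using hM a j
    choose g hg using hcr
    have hη' : η = ∑ k, (C c⁻¹ * g k) • mkDerivation ℂ (M k) := by
      refine derivation_ext fun i => ?_
      have h1 := congrFun (Matrix.mulVec_cramer M.transpose y) i
      rw [Matrix.det_transpose, hu] at h1
      simp only [Matrix.mulVec, dotProduct, Matrix.transpose_apply, hg, Pi.smul_apply,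
        smul_eq_mul] at h1
      have h2 : Q * ∑ k, M k i * g k = Q * (C c * y i) := by
        rw [← mul_assoc, ← h1, Finset.mul_sum]
        exact Finset.sum_congr rfl fun k _ => by ring
      have h3 := mul_left_cancel₀ hQ0 h2
      have h4 : (C c⁻¹ * C c : PolyS ℓ) = 1 := by rw [← map_mul, inv_mul_cancel₀ hc, map_one]
      have h5 : η (X i) = C c⁻¹ * ∑ k, M k i * g k := by
        rw [h3, ← mul_assoc, h4, one_mul]
      rw [h5, derivation_sum_apply, Finset.mul_sum]
      refine Finset.sum_congr rfl fun k _ => ?_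
      rw [Derivation.smul_apply, mkDerivation_X, smul_eq_mul]
      ring
    rw [hη']
    exact Submodule.sum_mem _ fun k _ =>
      Submodule.smul_mem _ _ (Submodule.subset_span ⟨k, rfl⟩)
  · simpa [mkDerivation_X] using hhom k i

/-- The linear functional `v ↦ v i - ζ * v j`. -/
def diffDual {ℓ : ℕ} (i j : Fin ℓ) (ζ : ℂ) : Module.Dual ℂ (VecV ℓ) :=
  LinearMap.proj i - ζ • LinearMap.proj j

lemma diffDual_apply {ℓ : ℕ} (i j : Fin ℓ) (ζ : ℂ) (v : VecV ℓ) :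
    diffDual i j ζ v = v i - ζ * v j := rfl

lemma sum_C_diffDual_mul {ℓ : ℕ} (i j : Fin ℓ) (ζ : ℂ) (f : Fin ℓ → PolyS ℓ) :
    ∑ k, C (diffDual i j ζ (Pi.single k 1)) * f k = f i - C ζ * f j := by
  simp [diffDual_apply, Pi.single_apply, sub_mul, Finset.sum_sub_distrib, apply_ite C, ite_mul]

lemma sum_C_proj_mul {ℓ : ℕ} (i : Fin ℓ) (f : Fin ℓ → PolyS ℓ) :
    ∑ k, C ((LinearMap.proj i : Module.Dual ℂ (VecV ℓ)) (Pi.single k 1)) * f k = f i := by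
  simp [Pi.single_apply]

lemma formPoly_diffDual {ℓ : ℕ} (i j : Fin ℓ) (ζ : ℂ) :
    formPoly (diffDual i j ζ) = diffForm i j ζ :=
  sum_C_diffDual_mul i j ζ X

lemma formPoly_proj {ℓ : ℕ} (i : Fin ℓ) :
    formPoly (LinearMap.proj i : Module.Dual ℂ (VecV ℓ)) = X i :=
  sum_C_proj_mul i X

lemma diffDual_ne_zero {ℓ : ℕ} {i j : Fin ℓ} (hij : i ≠ j) (ζ : ℂ) : diffDual i j ζ ≠ 0 := by
  intro h
  have := LinearMap.congr_fun h (Pi.single i 1)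
  simp [diffDual_apply, hij.symm] at this

lemma not_diffForm_dvd_X {ℓ : ℕ} {i j : Fin ℓ} (hij : i ≠ j) {ζ : ℂ} (hζ : ζ ≠ 0) {k : Fin ℓ}
    (hk : k = i ∨ k = j) : ¬ diffForm i j ζ ∣ X k := by
  rw [← formPoly_diffDual, ← formPoly_proj]
  intro h
  have hv : (Pi.single i ζ + Pi.single j 1 : VecV ℓ) ∈ LinearMap.ker (diffDual i j ζ) := by
    simp [diffDual_apply, hij, hij.symm]
  have := ker_le_of_formPoly_dvd h hv
  rcases hk with rfl | rfl
  · simp [hij, hζ] at this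
  · simp [hij.symm] at this

lemma isHomogeneous_of_X_pow_mul {ℓ N p : ℕ} (i : Fin ℓ) {f : PolyS ℓ}
    (h : (X i ^ N * f).IsHomogeneous (N + p)) : f.IsHomogeneous p := by
  intro c hc
  have h1 : (X i ^ N * f).coeff (Finsupp.single i N + c) ≠ 0 := by
    rwa [X_pow_eq_monomial, coeff_monomial_mul, one_mul]
  have h2 := h h1
  rw [map_add] at h2
  simpa [Finsupp.weight_single] using h2

/-- The power of `x_i` cancelled from the numerators of the basic derivations. -/
lemma exists_shift {r δ : ℕ} (hr : 0 < r) (hδ : δ ≤ r) (μ : ℕ) :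
    ∃ N b, r ∣ N ∧ b < r ∧ N + (μ + 1) * δ = r * μ + b + 1 := by
  obtain ⟨t, rfl⟩ := Nat.exists_eq_add_of_le hδ
  refine ⟨(δ + t) * ((μ + 1) * t / (δ + t)), δ + t - 1 - (μ + 1) * t % (δ + t),
    dvd_mul_right _ _, by omega, ?_⟩
  have h1 := Nat.div_add_mod ((μ + 1) * t) (δ + t)
  have h2 := Nat.mod_lt ((μ + 1) * t) hr
  have h3 : (μ + 1) * t + (μ + 1) * δ = (δ + t) * μ + (δ + t) := by ring
  omega

/-- The coefficient matrix of a basis of derivations. -/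
lemma exists_derivation_matrix {ℓ r δ : ℕ} (hr : 2 ≤ r) (hℓ : 1 ≤ ℓ) (hδ : δ ≤ r) (m : ℕ) :
    ∃ M : Matrix (Fin ℓ) (Fin ℓ) (PolyS ℓ),
      (∀ k i, X i ^ (m * δ) ∣ M k i) ∧
      (∀ k i j ζ, i ≠ j → ζ ^ r = 1 → diffForm i j ζ ^ (m * 2) ∣ M k i - C ζ * M k j) ∧
      (∀ k i, (M k i).IsHomogeneous (m * ((ℓ - 1) * r + δ))) ∧ M.det ≠ 0 := by
  rcases m with _ | μ
  · refine ⟨1, by simp, by simp, fun k i => ?_, by simp⟩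
    rw [zero_mul, Matrix.one_apply]
    split_ifs
    exacts [isHomogeneous_one _ _, isHomogeneous_zero _ _ _]
  obtain ⟨N, b, hN, hb, hNb⟩ := exists_shift (by omega : 0 < r) hδ μ
  set E : Fin ℓ → Fin ℓ → PolyS ℓ :=
    fun k i => (integ r N (integrand r μ k)).eval (X i ^ r) with hE
  have hdvd (k i : Fin ℓ) : X i ^ (N + (μ + 1) * δ) ∣ X k ^ b * X i * E k i := by
    have h1 := pow_dvd_eval_integrand r μ N i k
    by_cases hik : i = k
    · subst hik
      rw [if_pos rfl] at h1
      have : (X i : PolyS ℓ) ^ (N + (μ + 1) * δ) = X i ^ b * X i * X i ^ (r * μ) := by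
        rw [hNb]; ring
      exact this ▸ mul_dvd_mul_left _ h1
    · rw [if_neg hik] at h1
      have h2 : (X i : PolyS ℓ) ^ (r * (μ + 1) + 1) ∣ X i * E k i := by
        rw [pow_succ']; exact mul_dvd_mul_left _ h1
      rw [mul_assoc]
      exact ((pow_dvd_pow _ (by rw [hNb, mul_add]; omega)).trans h2).mul_left _
  have hX (i : Fin ℓ) : (X i : PolyS ℓ) ^ N ≠ 0 := pow_ne_zero _ (X_ne_zero i)
  choose g hg using hdvd
  have hnum (k i : Fin ℓ) : X k ^ b * X i * E k i = X i ^ N * (X i ^ ((μ + 1) * δ) * g k i) := by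
    rw [hg, pow_add, mul_assoc]
  refine ⟨fun k i => X i ^ ((μ + 1) * δ) * g k i, fun k i => dvd_mul_right _ _, ?_, ?_, ?_⟩
  · intro k i j ζ hij hζ
    have hζ0 : ζ ≠ 0 := by
      rintro rfl
      rw [zero_pow (by omega)] at hζ
      exact zero_ne_one hζ
    have hp : Prime (diffForm i j ζ) :=
      formPoly_diffDual i j ζ ▸ prime_formPoly (diffDual_ne_zero hij ζ)
    have hXi := not_diffForm_dvd_X hij hζ0 (Or.inl rfl)
    have hXj := not_diffForm_dvd_X hij hζ0 (Or.inr rfl)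
    obtain ⟨p, q, R, hI, hR, hq, hpq⟩ := integrand_eq r μ hij k
    have h1 := pow_diffForm_dvd_integDiff hr hN hij hζ hp hXi hR hq p
    have h2 : diffForm i j ζ ^ ((μ + 1) * 2) ∣ integDiff r N i j ζ (integrand r μ k) := by
      rw [hI]
      exact (pow_dvd_pow _ (by omega)).trans h1
    refine hp.pow_dvd_of_dvd_mul_left _ (a := X i ^ N * X j ^ N) ?_ ?_
    · intro h
      rcases hp.dvd_or_dvd h with h | h
      exacts [hXi (hp.dvd_of_dvd_pow h), hXj (hp.dvd_of_dvd_pow h)]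
    · convert h2.mul_left (X k ^ b) using 1
      have e1 := hnum k i
      have e2 := hnum k j
      rw [integDiff]
      linear_combination (-(X j : PolyS ℓ) ^ N) * e1 + C ζ * X i ^ N * e2
  · intro k i
    refine isHomogeneous_of_X_pow_mul (N := N) i ?_
    rw [← hnum]
    have h1 := (((isHomogeneous_X ℂ k).pow b).mul (isHomogeneous_X ℂ i)).mul
      ((weightedHom_integrand r μ k).isHomogeneous_eval_integ N i)
    convert h1 using 1
    obtain ⟨n, rfl⟩ := Nat.exists_eq_add_of_le' hℓ
    simp only [Nat.add_sub_cancel]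
    linear_combination hNb
  · intro hdet
    obtain ⟨a, ha, h0⟩ := Matrix.exists_vecMul_eq_zero_iff.mpr hdet
    have h1 : (fun k => a k * X k ^ b) = 0 := by
      refine integrand_independent (μ := μ) hr hN hℓ _ fun i => ?_
      have h2 : ∑ k, a k * (X i ^ ((μ + 1) * δ) * g k i) = 0 := congrFun h0 i
      refine (mul_eq_zero.mp ?_).resolve_left (X_ne_zero (R := ℂ) i)
      rw [← mul_zero (X i ^ N), ← h2, Finset.mul_sum, Finset.mul_sum]
      refine Finset.sum_congr rfl fun k _ => ?_
      linear_combination a k * hnum k i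
    refine ha (funext fun k => ?_)
    exact (mul_eq_zero.mp (congrFun h1 k)).resolve_right (pow_ne_zero _ (X_ne_zero k))

/-- `w` is the monomial map `e_i ↦ z i • e_{σ i}`. -/
def IsMonomial {ℓ : ℕ} (σ : Equiv.Perm (Fin ℓ)) (z : Fin ℓ → ℂ) (w : GLV ℓ) : Prop :=
  ∀ v : VecV ℓ, ∀ i, (w : Module.End ℂ (VecV ℓ)) v (σ i) = z i * v i

/-- Membership in `G(r, r / d, ℓ)`. -/
def IsImprimitive {ℓ : ℕ} (r d : ℕ) (w : GLV ℓ) : Prop :=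
  ∃ σ : Equiv.Perm (Fin ℓ), ∃ z : Fin ℓ → ℂ,
    (∀ i, z i ^ r = 1) ∧ (∏ i, z i) ^ d = 1 ∧ IsMonomial σ z w

lemma exists_isMonomial {ℓ : ℕ} (σ : Equiv.Perm (Fin ℓ)) (z : Fin ℓ → ℂ) (hz : ∀ i, z i ≠ 0) :
    ∃ w : GLV ℓ, IsMonomial σ z w := by
  let f : VecV ℓ ≃ₗ[ℂ] VecV ℓ :=
    (LinearEquiv.piCongrRight fun i => LinearEquiv.smulOfNeZero ℂ ℂ (z i) (hz i)).trans
      (LinearEquiv.funCongrLeft ℂ ℂ σ.symm)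
  refine ⟨(LinearMap.GeneralLinearGroup.generalLinearEquiv ℂ (VecV ℓ)).symm f, fun v i => ?_⟩
  change f v (σ i) = _
  simp [f, LinearMap.funLeft_apply]

lemma glv_ext {ℓ : ℕ} {w w' : GLV ℓ}
    (h : ∀ v i, (w : Module.End ℂ (VecV ℓ)) v i = (w' : Module.End ℂ (VecV ℓ)) v i) : w = w' :=
  Units.ext (LinearMap.ext fun v => funext (h v))

lemma mem_ker_sub_one {ℓ : ℕ} (w : GLV ℓ) (v : VecV ℓ) :
    v ∈ LinearMap.ker ((w : Module.End ℂ (VecV ℓ)) - 1) ↔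
      (w : Module.End ℂ (VecV ℓ)) v = v := by
  rw [LinearMap.mem_ker, LinearMap.sub_apply, Module.End.one_apply, sub_eq_zero]

lemma finrank_ker_dual {ℓ : ℕ} {φ : Module.Dual ℂ (VecV ℓ)} (hφ : φ ≠ 0) :
    Module.finrank ℂ (LinearMap.ker φ) = ℓ - 1 := by
  have := Module.Dual.finrank_ker_add_one_of_ne_zero hφ
  rw [Module.finrank_fin_fun] at this
  omega

lemma IsReflection.ker_eq {ℓ : ℕ} {w : Module.End ℂ (VecV ℓ)} (hw : IsReflection w)
    {φ : Module.Dual ℂ (VecV ℓ)} (hφ : φ ≠ 0)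
    (h : LinearMap.ker (w - 1) ≤ LinearMap.ker φ) : LinearMap.ker (w - 1) = LinearMap.ker φ :=
  Submodule.eq_of_le_of_finrank_eq h (hw.trans (finrank_ker_dual hφ).symm)

lemma ne_zero_of_pow_eq_one {r : ℕ} (hr : 0 < r) {ζ : ℂ} (h : ζ ^ r = 1) : ζ ≠ 0 := by
  rintro rfl
  rw [zero_pow hr.ne'] at h
  exact zero_ne_one h

lemma proj_ne_zero {ℓ : ℕ} (i : Fin ℓ) : (LinearMap.proj i : Module.Dual ℂ (VecV ℓ)) ≠ 0 := by
  intro h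
  simpa using LinearMap.congr_fun h (Pi.single i 1)

lemma ker_diffDual_inv {ℓ : ℕ} (i j : Fin ℓ) {ζ : ℂ} (hζ : ζ ≠ 0) :
    LinearMap.ker (diffDual i j ζ) = LinearMap.ker (diffDual j i ζ⁻¹) := by
  ext v
  rw [LinearMap.mem_ker, LinearMap.mem_ker, diffDual_apply, diffDual_apply, sub_eq_zero,
    sub_eq_zero, eq_inv_mul_iff_mul_eq₀ hζ, eq_comm]

/-- The swap of coordinates `i` and `j` fixing the hyperplane `v i = ζ * v j`. -/
lemma exists_pair_swap {ℓ r d : ℕ} (hr : 0 < r) {i j : Fin ℓ} (hij : i ≠ j) {ζ : ℂ}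
    (hζ : ζ ^ r = 1) :
    ∃ s : GLV ℓ, IsImprimitive r d s ∧ ∀ v, (s : Module.End ℂ (VecV ℓ)) v i = ζ * v j ∧
      (s : Module.End ℂ (VecV ℓ)) v j = ζ⁻¹ * v i ∧
      ∀ k, k ≠ i → k ≠ j → (s : Module.End ℂ (VecV ℓ)) v k = v k := by
  have hζ0 := ne_zero_of_pow_eq_one hr hζ
  set z : Fin ℓ → ℂ := Pi.mulSingle i ζ⁻¹ * Pi.mulSingle j ζ with hz
  have hzi : z i = ζ⁻¹ := by simp [hz, hij]
  have hzj : z j = ζ := by simp [hz, hij.symm]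
  have hzk (k : Fin ℓ) (h1 : k ≠ i) (h2 : k ≠ j) : z k = 1 := by simp [hz, h1, h2]
  have hzr (k : Fin ℓ) : z k ^ r = 1 := by
    rcases eq_or_ne k i with rfl | h1
    · rw [hzi, inv_pow, hζ, inv_one]
    rcases eq_or_ne k j with rfl | h2
    · rw [hzj, hζ]
    · rw [hzk k h1 h2, one_pow]
  obtain ⟨s, hs⟩ := exists_isMonomial (Equiv.swap i j) z fun k => ne_zero_of_pow_eq_one hr (hzr k)
  refine ⟨s, ⟨_, z, hzr, ?_, hs⟩, fun v => ⟨?_, ?_, fun k h1 h2 => ?_⟩⟩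
  · simp [hz, Finset.prod_mul_distrib, hζ0]
  · simpa [hzj] using hs v j
  · simpa [hzi] using hs v i
  · simpa [hzk k h1 h2, Equiv.swap_apply_of_ne_of_ne h1 h2] using hs v k

/-- The diagonal map multiplying the coordinate `i` by `ζ`. -/
lemma exists_diagonal {ℓ r d : ℕ} (hd : 0 < d) (hdr : d ∣ r) (i : Fin ℓ) {ζ : ℂ} (hζ : ζ ^ d = 1) :
    ∃ s : GLV ℓ, IsImprimitive r d s ∧ ∀ v, (s : Module.End ℂ (VecV ℓ)) v i = ζ * v i ∧
      ∀ k, k ≠ i → (s : Module.End ℂ (VecV ℓ)) v k = v k := by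
  set z : Fin ℓ → ℂ := Pi.mulSingle i ζ with hz
  have hzi : z i = ζ := by simp [hz]
  have hzk (k : Fin ℓ) (h1 : k ≠ i) : z k = 1 := by simp [hz, h1]
  have hzd (k : Fin ℓ) : z k ^ d = 1 := by
    rcases eq_or_ne k i with rfl | h1
    · rw [hzi, hζ]
    · rw [hzk k h1, one_pow]
  obtain ⟨s, hs⟩ := exists_isMonomial 1 z fun k => ne_zero_of_pow_eq_one hd (hzd k)
  refine ⟨s, ⟨_, z, fun k => ?_, ?_, hs⟩, fun v => ⟨?_, fun k h1 => ?_⟩⟩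
  · obtain ⟨e, rfl⟩ := hdr
    rw [pow_mul, hzd, one_pow]
  · rw [← Finset.prod_pow]
    exact Finset.prod_eq_one fun k _ => hzd k
  · simpa [hzi] using hs v i
  · simpa [hzk k h1] using hs v k

lemma isMonomial_ker_le_diffDual {ℓ : ℕ} {σ : Equiv.Perm (Fin ℓ)} {z : Fin ℓ → ℂ} {w : GLV ℓ}
    (hw : IsMonomial σ z w) (i : Fin ℓ) :
    LinearMap.ker ((w : Module.End ℂ (VecV ℓ)) - 1) ≤ LinearMap.ker (diffDual (σ i) i (z i)) := by
  intro v hv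
  rw [mem_ker_sub_one] at hv
  rw [LinearMap.mem_ker, diffDual_apply, sub_eq_zero, ← hw v i, hv]

/-- A monomial map fixing `e_k` has trivial `k`-th column. -/
lemma IsMonomial.of_fix_single {ℓ : ℕ} {σ : Equiv.Perm (Fin ℓ)} {z : Fin ℓ → ℂ} {w : GLV ℓ}
    (hw : IsMonomial σ z w) {k : Fin ℓ} (hz : z k ≠ 0)
    (h : (w : Module.End ℂ (VecV ℓ)) (Pi.single k 1) = Pi.single k 1) : σ k = k ∧ z k = 1 := by
  have h1 := hw (Pi.single k 1) k
  rw [h, Pi.single_eq_same, mul_one, Pi.single_apply] at h1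
  split_ifs at h1 with h2
  exacts [⟨h2, h1.symm⟩, absurd h1.symm hz]

lemma ker_reflection_of_isImprimitive {ℓ r d : ℕ} (hr : 0 < r) (hd : 0 < d) (hℓ : 1 ≤ ℓ) {w : GLV ℓ}
    (hw : IsImprimitive r d w) (href : IsReflection (w : Module.End ℂ (VecV ℓ))) :
    (∃ i j, i < j ∧ ∃ ζ : ℂ, ζ ^ r = 1 ∧
      LinearMap.ker ((w : Module.End ℂ (VecV ℓ)) - 1) = LinearMap.ker (diffDual i j ζ)) ∨
    (2 ≤ d ∧ ∃ i, LinearMap.ker ((w : Module.End ℂ (VecV ℓ)) - 1) =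
      LinearMap.ker (LinearMap.proj i : Module.Dual ℂ (VecV ℓ))) := by
  obtain ⟨σ, z, hzr, hzd, hw⟩ := hw
  have hz0 (k : Fin ℓ) := ne_zero_of_pow_eq_one hr (hzr k)
  by_cases hσ : ∃ i, σ i ≠ i
  · obtain ⟨i, hi⟩ := hσ
    left
    have hk := href.ker_eq (diffDual_ne_zero hi _) (isMonomial_ker_le_diffDual hw i)
    rcases lt_or_gt_of_ne hi with h | h
    · exact ⟨_, _, h, _, hzr i, hk⟩
    · refine ⟨_, _, h, (z i)⁻¹, by rw [inv_pow, hzr, inv_one], ?_⟩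
      rw [hk, ker_diffDual_inv _ _ (hz0 i)]
  · push Not at hσ
    have hw' (v : VecV ℓ) (k : Fin ℓ) : (w : Module.End ℂ (VecV ℓ)) v k = z k * v k := by
      simpa [hσ k] using hw v k
    right
    obtain ⟨i, hi⟩ : ∃ i, z i ≠ 1 := by
      by_contra! h
      have h1 : (w : Module.End ℂ (VecV ℓ)) - 1 = 0 :=
        LinearMap.ext fun v => funext fun k => by simp [hw', h]
      rw [IsReflection, h1, LinearMap.ker_zero, finrank_top, Module.finrank_fin_fun] at href
      omega
    have hk := href.ker_eq (proj_ne_zero i) fun v hv => by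
      rw [LinearMap.mem_ker, LinearMap.proj_apply]
      have h1 := congrFun ((mem_ker_sub_one w v).mp hv) i
      rw [hw'] at h1
      exact (mul_eq_zero.mp (by linear_combination h1)).resolve_left (sub_ne_zero.mpr hi)
    have hz1 (k : Fin ℓ) (h : k ≠ i) : z k = 1 := by
      refine (hw.of_fix_single (hz0 k) ((mem_ker_sub_one w _).mp ?_)).2
      simp [hk, h.symm]
    refine ⟨?_, i, hk⟩
    rw [Finset.prod_eq_single i (fun k _ h => hz1 k h) (by simp)] at hzd
    by_contra hlt
    obtain rfl : d = 1 := by omega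
    exact hi (by simpa using hzd)

lemma mem_reflArr_iff {ℓ r d : ℕ} (hr : 0 < r) (hd : 0 < d) (hdr : d ∣ r) (hℓ : 1 ≤ ℓ)
    {W : Subgroup (GLV ℓ)} (hW : ∀ w, w ∈ W ↔ IsImprimitive r d w)
    (H : Submodule ℂ (VecV ℓ)) : H ∈ reflArr W ↔
      (∃ i j, i < j ∧ ∃ ζ : ℂ, ζ ^ r = 1 ∧ H = LinearMap.ker (diffDual i j ζ)) ∨
      (2 ≤ d ∧ ∃ i, H = LinearMap.ker (LinearMap.proj i : Module.Dual ℂ (VecV ℓ))) := by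
  constructor
  · rintro ⟨w, hw, href, rfl⟩
    exact ker_reflection_of_isImprimitive hr hd hℓ ((hW w).mp hw) href
  · rintro (⟨i, j, hij, ζ, hζ, rfl⟩ | ⟨hd2, i, rfl⟩)
    · obtain ⟨s, hs, hsv⟩ := exists_pair_swap (d := d) hr hij.ne hζ
      have hζ0 := ne_zero_of_pow_eq_one hr hζ
      have hker : LinearMap.ker (diffDual i j ζ) =
          LinearMap.ker ((s : Module.End ℂ (VecV ℓ)) - 1) := by
        ext v
        obtain ⟨h1, h2, h3⟩ := hsv v
        rw [mem_ker_sub_one, LinearMap.mem_ker, diffDual_apply, sub_eq_zero]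
        constructor
        · intro h
          funext k
          by_cases hki : k = i
          · rw [hki, h1, h]
          by_cases hkj : k = j
          · rw [hkj, h2, h, inv_mul_cancel_left₀ hζ0]
          · exact h3 k hki hkj
        · intro h
          rw [← h1, h]
      refine ⟨s, (hW s).mpr hs, ?_, hker⟩
      rw [IsReflection, ← hker, finrank_ker_dual (diffDual_ne_zero hij.ne ζ)]
    · have hζ := Complex.isPrimitiveRoot_exp d hd.ne'
      obtain ⟨s, hs, hsv⟩ := exists_diagonal hd hdr i hζ.pow_eq_one
      have hker : LinearMap.ker (LinearMap.proj i : Module.Dual ℂ (VecV ℓ)) =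
          LinearMap.ker ((s : Module.End ℂ (VecV ℓ)) - 1) := by
        ext v
        obtain ⟨h1, h2⟩ := hsv v
        rw [mem_ker_sub_one, LinearMap.mem_ker, LinearMap.proj_apply]
        constructor
        · intro h
          funext k
          by_cases hki : k = i
          · rw [hki, h1, h, mul_zero]
          · exact h2 k hki
        · intro h
          rw [h] at h1
          exact (mul_eq_zero.mp (by linear_combination -h1)).resolve_left
            (sub_ne_zero.mpr (hζ.ne_one hd2))
      refine ⟨s, (hW s).mpr hs, ?_, hker⟩
      rw [IsReflection, ← hker, finrank_ker_dual (proj_ne_zero i)]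

lemma orderMult_diffDual {ℓ r d : ℕ} (hr : 0 < r) {W : Subgroup (GLV ℓ)}
    (hW : ∀ w, w ∈ W ↔ IsImprimitive r d w) {i j : Fin ℓ} (hij : i ≠ j) {ζ : ℂ} (hζ : ζ ^ r = 1) :
    orderMult W (LinearMap.ker (diffDual i j ζ)) = 2 := by
  obtain ⟨s, hs, hsv⟩ := exists_pair_swap (d := d) hr hij hζ
  have hζ0 := ne_zero_of_pow_eq_one hr hζ
  have hfix : ∀ v ∈ LinearMap.ker (diffDual i j ζ), (s : Module.End ℂ (VecV ℓ)) v = v := by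
    intro v hv
    obtain ⟨h1, h2, h3⟩ := hsv v
    rw [LinearMap.mem_ker, diffDual_apply, sub_eq_zero] at hv
    funext k
    by_cases hki : k = i
    · rw [hki, h1, hv]
    by_cases hkj : k = j
    · rw [hkj, h2, hv, inv_mul_cancel_left₀ hζ0]
    · exact h3 k hki hkj
  rw [orderMult, Nat.card_eq_two_iff]
  refine ⟨⟨1, W.one_mem, fun _ _ => rfl⟩, ⟨s, (hW s).mpr hs, hfix⟩, fun h => ?_, ?_⟩
  · have h1 := (hsv (Pi.single i 1)).1
    rw [← show (1 : GLV ℓ) = s from congrArg Subtype.val h] at h1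
    simp [hij.symm] at h1
  · refine Set.eq_univ_of_forall fun ⟨w, hwW, hwH⟩ => ?_
    obtain ⟨σ, z, hzr, -, hw⟩ := (hW w).mp hwW
    have hz0 (k : Fin ℓ) := ne_zero_of_pow_eq_one hr (hzr k)
    have hk (k : Fin ℓ) (h1 : k ≠ i) (h2 : k ≠ j) : σ k = k ∧ z k = 1 := by
      refine hw.of_fix_single (hz0 k) (hwH _ ?_)
      simp [diffDual_apply, h1.symm, h2.symm]
    set u : VecV ℓ := Pi.single i ζ + Pi.single j 1 with hu
    have hui : u i = ζ := by simp [hu, hij]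
    have huj : u j = 1 := by simp [hu, hij.symm]
    have hux (k : Fin ℓ) : u (σ k) = z k * u k := by
      rw [← hw u k, hwH u]
      rw [LinearMap.mem_ker, diffDual_apply, hui, huj, mul_one, sub_self]
    have hσ (k : Fin ℓ) (h : u k ≠ 0) : σ k = i ∨ σ k = j := by
      by_contra! hne
      have h0 : u (σ k) = 0 := by simp [hu, hne.1, hne.2]
      exact mul_ne_zero (hz0 k) h (hux k ▸ h0)
    have hj := hσ j (by rw [huj]; exact one_ne_zero)
    rcases hσ i (by rwa [hui]) with hσi | hσi
    · have hσj : σ j = j := hj.resolve_left fun h => hij (σ.injective (hσi.trans h.symm))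
      left
      refine Subtype.ext (glv_ext fun v k => ?_)
      have hzi := hux i
      have hzj := hux j
      rw [hσi, hui] at hzi
      rw [hσj, huj, mul_one] at hzj
      change (w : Module.End ℂ (VecV ℓ)) v k = v k
      by_cases hki : k = i
      · have := hw v i
        rw [hσi] at this
        rw [hki, this, (mul_eq_right₀ hζ0).mp hzi.symm, one_mul]
      by_cases hkj : k = j
      · have := hw v j
        rw [hσj] at this
        rw [hkj, this, ← hzj, one_mul]
      · have := hw v k
        rwa [(hk k hki hkj).1, (hk k hki hkj).2, one_mul] at this
    · have hσj : σ j = i := hj.resolve_right fun h => hij (σ.injective (hσi.trans h.symm))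
      right
      refine Subtype.ext (glv_ext fun v k => ?_)
      obtain ⟨h1, h2, h3⟩ := hsv v
      have hzi := hux i
      have hzj := hux j
      rw [hσi, hui, huj] at hzi
      rw [hσj, hui, huj, mul_one] at hzj
      by_cases hki : k = i
      · have := hw v j
        rw [hσj] at this
        rw [hki, this, h1, hzj]
      by_cases hkj : k = j
      · have := hw v i
        rw [hσi] at this
        rw [hkj, this, h2, eq_inv_of_mul_eq_one_left hzi.symm]
      · have := hw v k
        rw [(hk k hki hkj).1, (hk k hki hkj).2, one_mul] at this
        rw [this, h3 k hki hkj]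

lemma coe_pow_eq_one {r : ℕ} (ζ : rootsOfUnity r ℂ) : ((ζ : ℂˣ) : ℂ) ^ r = 1 :=
  congrArg Units.val ((mem_rootsOfUnity r _).mp ζ.2)

lemma orderMult_proj {ℓ r d : ℕ} (hr : 0 < r) (hd : 0 < d) (hdr : d ∣ r) {W : Subgroup (GLV ℓ)}
    (hW : ∀ w, w ∈ W ↔ IsImprimitive r d w) (i : Fin ℓ) :
    orderMult W (LinearMap.ker (LinearMap.proj i : Module.Dual ℂ (VecV ℓ))) = d := by
  have : NeZero d := ⟨hd.ne'⟩
  choose s hs hsv using fun ζ : rootsOfUnity d ℂ => exists_diagonal hd hdr i (coe_pow_eq_one ζ)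
  have hfix (ζ : rootsOfUnity d ℂ) :
      ∀ v ∈ LinearMap.ker (LinearMap.proj i : Module.Dual ℂ (VecV ℓ)),
        (s ζ : Module.End ℂ (VecV ℓ)) v = v := by
    intro v hv
    obtain ⟨h1, h2⟩ := hsv ζ v
    rw [LinearMap.mem_ker, LinearMap.proj_apply] at hv
    funext k
    by_cases hki : k = i
    · rw [hki, h1, hv, mul_zero]
    · exact h2 k hki
  have hbij : Function.Bijective fun ζ : rootsOfUnity d ℂ =>
      (⟨s ζ, (hW _).mpr (hs ζ), hfix ζ⟩ : {w : GLV ℓ // w ∈ W ∧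
        ∀ v ∈ LinearMap.ker (LinearMap.proj i : Module.Dual ℂ (VecV ℓ)),
          (w : Module.End ℂ (VecV ℓ)) v = v}) := by
    refine ⟨fun ζ ξ h => ?_, fun ⟨w, hwW, hwH⟩ => ?_⟩
    · have h1 := (hsv ζ (Pi.single i 1)).1
      rw [show s ζ = s ξ from congrArg Subtype.val h, (hsv ξ (Pi.single i 1)).1] at h1
      exact Subtype.ext (Units.ext (by simpa using h1.symm))
    · obtain ⟨σ, z, hzr, hzd, hw⟩ := (hW w).mp hwW
      have hz0 (k : Fin ℓ) := ne_zero_of_pow_eq_one hr (hzr k)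
      have hk (k : Fin ℓ) (h1 : k ≠ i) : σ k = k ∧ z k = 1 := by
        refine hw.of_fix_single (hz0 k) (hwH _ ?_)
        simp [h1.symm]
      rw [Finset.prod_eq_single i (fun k _ h => (hk k h).2) (by simp)] at hzd
      have hσi : σ i = i := by
        by_contra h
        exact h (σ.injective (hk _ h).1)
      refine ⟨⟨Units.mk0 (z i) (hz0 i), (mem_rootsOfUnity d _).mpr (Units.ext hzd)⟩, ?_⟩
      refine Subtype.ext (glv_ext fun v k => ?_)
      by_cases hki : k = i
      · have := hw v i
        rw [hσi] at this
        rw [hki, (hsv _ v).1, this]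
        rfl
      · have := hw v k
        rw [(hk k hki).1, (hk k hki).2, one_mul] at this
        rw [this, (hsv _ v).2 k hki]
  rw [orderMult, ← Nat.card_eq_of_bijective _ hbij, Complex.card_rootsOfUnity]

/-- Indices for the hyperplanes `v i = ζ * v j` and, if `2 ≤ d`, `v i = 0`. -/
abbrev HypIndex (ℓ r d : ℕ) : Type :=
  ({p : Fin ℓ × Fin ℓ // p.1 < p.2} × rootsOfUnity r ℂ) ⊕ {_i : Fin ℓ // 2 ≤ d}

/-- The linear functional attached to an index. -/
def hypDual {ℓ r d : ℕ} : HypIndex ℓ r d → Module.Dual ℂ (VecV ℓ) :=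
  Sum.elim (fun a => diffDual a.1.1.1 a.1.1.2 ((a.2 : ℂˣ) : ℂ)) (fun i => LinearMap.proj i.1)

lemma hypDual_ne_zero {ℓ r d : ℕ} (a : HypIndex ℓ r d) : hypDual a ≠ 0 := by
  rcases a with a | i
  exacts [diffDual_ne_zero a.1.2.ne _, proj_ne_zero _]

lemma reflArr_eq_range {ℓ r d : ℕ} (hr : 0 < r) (hd : 0 < d) (hdr : d ∣ r) (hℓ : 1 ≤ ℓ)
    {W : Subgroup (GLV ℓ)} (hW : ∀ w, w ∈ W ↔ IsImprimitive r d w) :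
    reflArr W = Set.range fun a : HypIndex ℓ r d => LinearMap.ker (hypDual a) := by
  ext H
  rw [mem_reflArr_iff hr hd hdr hℓ hW]
  constructor
  · rintro (⟨i, j, hij, ζ, hζ, rfl⟩ | ⟨hd2, i, rfl⟩)
    · exact ⟨Sum.inl ⟨⟨(i, j), hij⟩, Units.mk0 ζ (ne_zero_of_pow_eq_one hr hζ),
        (mem_rootsOfUnity r _).mpr (Units.ext hζ)⟩, rfl⟩
    · exact ⟨Sum.inr ⟨i, hd2⟩, rfl⟩
  · rintro ⟨a | i, rfl⟩
    · exact Or.inl ⟨_, _, a.1.2, _, coe_pow_eq_one a.2, rfl⟩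
    · exact Or.inr ⟨i.2, _, rfl⟩

lemma single_mem_ker_diffDual {ℓ : ℕ} {i j : Fin ℓ} {ζ : ℂ} (hij : i ≠ j) (hζ : ζ ≠ 0)
    (k : Fin ℓ) : Pi.single k 1 ∈ LinearMap.ker (diffDual i j ζ) ↔ k ≠ i ∧ k ≠ j := by
  rw [LinearMap.mem_ker, diffDual_apply, Pi.single_apply, Pi.single_apply]
  by_cases h1 : i = k
  · simp [← h1, hij.symm]
  · by_cases h2 : j = k
    · simp [← h2, hij, hζ]
    · simp [h1, h2, Ne.symm h1, Ne.symm h2]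

lemma single_mem_ker_proj {ℓ : ℕ} (i k : Fin ℓ) :
    Pi.single k 1 ∈ LinearMap.ker (LinearMap.proj i : Module.Dual ℂ (VecV ℓ)) ↔ k ≠ i := by
  simp [Pi.single_apply, eq_comm]

lemma ker_diffDual_ne_ker_proj {ℓ : ℕ} {i j : Fin ℓ} {ζ : ℂ} (hij : i ≠ j) (hζ : ζ ≠ 0)
    (k : Fin ℓ) : LinearMap.ker (diffDual i j ζ) ≠
      LinearMap.ker (LinearMap.proj k : Module.Dual ℂ (VecV ℓ)) := by
  intro h
  have key (n : Fin ℓ) : n ≠ i ∧ n ≠ j ↔ n ≠ k := by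
    rw [← single_mem_ker_diffDual hij hζ, h, single_mem_ker_proj]
  have h1 := key i
  have h2 := key j
  grind

lemma ker_hypDual_injective {ℓ r d : ℕ} :
    Function.Injective fun a : HypIndex ℓ r d => LinearMap.ker (hypDual a) := by
  rintro (⟨⟨⟨i, j⟩, hij⟩, ζ⟩ | ⟨i, hd⟩) (⟨⟨⟨i', j'⟩, hij'⟩, ζ'⟩ | ⟨i', hd'⟩) h
  · have hij : i < j := hij
    have hij' : i' < j' := hij'
    have h : LinearMap.ker (diffDual i j ((ζ : ℂˣ) : ℂ)) =
      LinearMap.ker (diffDual i' j' ((ζ' : ℂˣ) : ℂ)) := h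
    have key (n : Fin ℓ) : n ≠ i ∧ n ≠ j ↔ n ≠ i' ∧ n ≠ j' := by
      rw [← single_mem_ker_diffDual hij.ne (ζ : ℂˣ).ne_zero, h,
        single_mem_ker_diffDual hij'.ne (ζ' : ℂˣ).ne_zero]
    have h1 := key i
    have h2 := key j
    obtain ⟨rfl, rfl⟩ : i = i' ∧ j = j' := by grind
    have hv : (Pi.single i ((ζ : ℂˣ) : ℂ) + Pi.single j 1 : VecV ℓ) ∈
        LinearMap.ker (diffDual i j ((ζ : ℂˣ) : ℂ)) := by
      simp [diffDual_apply, hij.ne, hij.ne']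
    rw [h, LinearMap.mem_ker, diffDual_apply, sub_eq_zero] at hv
    have hζ : ζ = ζ' := Subtype.ext (Units.ext (by simpa [hij.ne, hij.ne'] using hv))
    rw [hζ]
  · exact absurd h (ker_diffDual_ne_ker_proj hij.ne (ζ : ℂˣ).ne_zero i')
  · exact absurd h.symm (ker_diffDual_ne_ker_proj hij'.ne (ζ' : ℂˣ).ne_zero i)
  · have key (n : Fin ℓ) : n ≠ i ↔ n ≠ i' := by
      rw [← single_mem_ker_proj, ← single_mem_ker_proj]
      exact Eq.to_iff (congrArg (Pi.single n 1 ∈ ·) h)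
    have hi : i = i' := by simpa using key i
    subst hi
    rfl

lemma card_pairs_mul_two (ℓ : ℕ) :
    Fintype.card {p : Fin ℓ × Fin ℓ // p.1 < p.2} * 2 = ℓ * (ℓ - 1) := by
  rw [← Finset.sum_range_id_mul_two, Fintype.card_subtype, Finset.card_filter,
    Fintype.sum_prod_type_right, ← Fin.sum_univ_eq_sum_range fun i => i]
  congr 1
  refine Finset.sum_congr rfl fun j _ => ?_
  rw [← Finset.card_filter]
  exact (congrArg Finset.card (by ext; simp)).trans (Fin.card_Iio j)

theorem stmt3 (d e ℓ : ℕ) (hd : 1 ≤ d) (he : 1 ≤ e) (hr : 2 ≤ d * e) (hℓ : 2 ≤ ℓ)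
    (W : Subgroup (GLV ℓ))
    -- `W = G(de, e, ℓ)`: the group of monomial matrices whose nonzero entries are
    -- `de`-th roots of unity with product a `d`-th root of unity.
    (hW : ∀ w : GLV ℓ, w ∈ W ↔ ∃ σ : Equiv.Perm (Fin ℓ), ∃ z : Fin ℓ → ℂ,
      (∀ i, z i ^ (d * e) = 1) ∧ (∏ i, z i) ^ d = 1 ∧
      ∀ v : VecV ℓ, ∀ i, (w : Module.End ℂ (VecV ℓ)) v (σ i) = z i * v i)
    (h : ℕ) (hcox : ℓ * h = ∑ᶠ H ∈ reflArr W, orderMult W H)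
    (m : ℕ) :
    IsFreeWithExponents (InDeriv (reflArr W) (fun H => m * orderMult W H))
      (fun _ => m * h) := by
  have hr0 : 0 < d * e := by omega
  have hNe : NeZero (d * e) := ⟨hr0.ne'⟩
  have hfin := Fintype.ofFinite (rootsOfUnity (d * e) ℂ)
  have hdr : d ∣ d * e := dvd_mul_right d e
  have hW' : ∀ w, w ∈ W ↔ IsImprimitive (d * e) d w := hW
  have hA := reflArr_eq_range hr0 hd hdr (by omega) hW'
  have hsum : ℓ * h = ∑ a : HypIndex ℓ (d * e) d, orderMult W (LinearMap.ker (hypDual a)) := by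
    rw [hcox, hA, finsum_mem_range ker_hypDual_injective, finsum_eq_sum_of_fintype]
  have hpair (a) : orderMult W (LinearMap.ker (hypDual (Sum.inl a : HypIndex ℓ (d * e) d))) = 2 :=
    orderMult_diffDual hr0 hW' a.1.2.ne (coe_pow_eq_one a.2)
  have hcoord (i) : orderMult W (LinearMap.ker (hypDual (Sum.inr i : HypIndex ℓ (d * e) d))) = d :=
    orderMult_proj hr0 hd hdr hW' i.1
  obtain ⟨δ, hδ, hδr, hδcard⟩ : ∃ δ, (2 ≤ d → δ = d) ∧ δ ≤ d * e ∧
      Fintype.card {_i : Fin ℓ // 2 ≤ d} * d = ℓ * δ := by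
    by_cases h2 : 2 ≤ d
    · exact ⟨d, fun _ => rfl, Nat.le_of_dvd hr0 hdr, by simp [h2, Fintype.card_subtype]⟩
    · exact ⟨0, fun h => absurd h h2, Nat.zero_le _, by simp [h2]⟩
  have hh : h = (ℓ - 1) * (d * e) + δ := by
    refine Nat.eq_of_mul_eq_mul_left (by omega : 0 < ℓ) ?_
    rw [hsum, Fintype.sum_sum_type]
    simp only [hpair, hcoord, Finset.sum_const, Finset.card_univ, Fintype.card_prod,
      ← Nat.card_eq_fintype_card (α := rootsOfUnity (d * e) ℂ), Complex.card_rootsOfUnity,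
      smul_eq_mul]
    rw [hδcard, mul_add, ← mul_assoc ℓ, ← card_pairs_mul_two]
    ring
  obtain ⟨M, hMX, hMdiff, hMhom, hMdet⟩ :=
    exists_derivation_matrix (ℓ := ℓ) hr (by omega) hδr m
  refine isFreeWithExponents_of_matrix hypDual hA ker_hypDual_injective hypDual_ne_zero ?_ M ?_
    (fun k i => hh ▸ hMhom k i) hMdet
  · rw [← Finset.mul_sum, ← hsum]
    ring
  · rintro (a | i) k
    · rw [hpair]
      change formPoly (diffDual _ _ _) ^ _ ∣ ∑ i, C (diffDual _ _ _ (Pi.single i 1)) * M k i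
      rw [sum_C_diffDual_mul, formPoly_diffDual]
      exact hMdiff k _ _ _ a.1.2.ne (coe_pow_eq_one a.2)
    · rw [hcoord]
      change formPoly (LinearMap.proj _) ^ _ ∣ ∑ j, C (LinearMap.proj i.1 (Pi.single j 1)) * M k j
      rw [sum_C_proj_mul, formPoly_proj]
      have hδd := hδ i.2
      exact hδd ▸ hMX k i.1
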